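/- Let P be a graded simplicial poset of rank n. Then for every T ⊆ [n], h(Δ(P̂_T), x) := Σ_{S ⊆ T} β_{P̂}(S) x^{|S|} = Σ_{k=0}^n h_k(P) · p^{(n+1)−T}_{n,k}(x), where (n+1)−T = {n+1−a : a ∈ T} and p^{(n+1)−T}_{n,k}(x) = Σ x^{des(w)} over all w ∈ S_{n+1} with w(1) = k+1 and Des(w) ⊆ (n+1)−T. -/

import Mathlib

open Polynomial

open scoped Classical

noncomputable section

/-- The descent set of a permutation `w` of `Fin n`, recorded as a subset of
`{1, ..., n-1}` (1-based positions, as in the paper: `i ∈ Des(w)` iff `w(i) > w(i+1)`). -/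
def descSet {n : ℕ} (w : Equiv.Perm (Fin n)) : Finset ℕ :=
  (Finset.univ.filter (fun i : Fin (n - 1) =>
      w ⟨i.val + 1, by have := i.isLt; omega⟩ < w ⟨i.val, by have := i.isLt; omega⟩)).image
    (fun i => i.val + 1)

/-- `A^T_n(x) = Σ_{w ∈ S_n, Des(w) ⊆ T} x^{des(w)}` (note `Des(w) ⊆ {1,...,n-1}`
automatically, so this also realizes the convention `A^T_n := A^{T ∩ [n-1]}_n`). -/
def Apoly (n : ℕ) (T : Finset ℕ) : Polynomial ℝ :=
  ∑ w ∈ Finset.univ.filter (fun w : Equiv.Perm (Fin n) => descSet w ⊆ T),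
    X ^ (descSet w).card

/-- `p^T_{n,k}(x) = Σ x^{des(w)}` over permutations `w ∈ S_{n+1}` with `w(1) = k+1`
(0-based: `w 0 = k`) and `Des(w) ⊆ T`. -/
def ppoly (n k : ℕ) (T : Finset ℕ) : Polynomial ℝ :=
  ∑ w ∈ Finset.univ.filter (fun w : Equiv.Perm (Fin (n + 1)) =>
      (w 0 : ℕ) = k ∧ descSet w ⊆ T),
    X ^ (descSet w).card

/-- A real polynomial has only real roots (or is identically zero). -/
def RealRooted (p : Polynomial ℝ) : Prop :=
  p = 0 ∨ ∀ z : ℂ, Polynomial.aeval z p = 0 → z.im = 0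

/-- The list of real roots of `p`, with multiplicity, in decreasing order. -/
def rootsDesc (p : Polynomial ℝ) : List ℝ :=
  (p.roots.sort (· ≤ ·)).reverse

/-- `Interlaces p q` means `p ⪯ q`: both are real-rooted and, listing the roots of `p`
as `α_1 ≥ α_2 ≥ ⋯` and those of `q` as `β_1 ≥ β_2 ≥ ⋯`, one has
`⋯ ≤ α_2 ≤ β_2 ≤ α_1 ≤ β_1`; by convention the zero polynomial interlaces and is
interlaced by every real-rooted polynomial. -/
def Interlaces (p q : Polynomial ℝ) : Prop :=
  (p = 0 ∧ RealRooted q) ∨ (q = 0 ∧ RealRooted p) ∨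
  (RealRooted p ∧ RealRooted q ∧
    Multiset.card q.roots ≤ Multiset.card p.roots + 1 ∧
    Multiset.card p.roots ≤ Multiset.card q.roots ∧
    (∀ (i : ℕ) (hp : i < (rootsDesc p).length) (hq : i < (rootsDesc q).length),
      (rootsDesc p).get ⟨i, hp⟩ ≤ (rootsDesc q).get ⟨i, hq⟩) ∧
    (∀ (i : ℕ) (hq : i + 1 < (rootsDesc q).length) (hp : i < (rootsDesc p).length),
      (rootsDesc q).get ⟨i + 1, hq⟩ ≤ (rootsDesc p).get ⟨i, hp⟩))

/-- The `T`-rank-selected subposet `P̂_T` of `P̂ = P ∪ {1̂}` (realized inside `WithTop P`):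
it consists of `0̂ = ⊥`, `1̂ = ⊤` and all elements of `P` whose rank lies in `T`. -/
def rankSel (P : Type*) [PartialOrder P] [OrderBot P] (ρ : P → ℕ) (T : Finset ℕ) :
    Set (WithTop P) :=
  {z | z = ⊤ ∨ z = ((⊥ : P) : WithTop P) ∨ ∃ y : P, z = (y : WithTop P) ∧ ρ y ∈ T}

/-- `α_{P̂}(T)`: the number of maximal chains of the rank-selected subposet `P̂_T`. -/
def alphaP (P : Type*) [PartialOrder P] [OrderBot P] (ρ : P → ℕ) (T : Finset ℕ) : ℕ :=
  Set.ncard {C : Set ↥(rankSel P ρ T) | IsMaxChain (· ≤ ·) C}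

/-- `β_{P̂}(T) = Σ_{S ⊆ T} (-1)^{|T∖S|} α_{P̂}(S)`. -/
def betaP (P : Type*) [PartialOrder P] [OrderBot P] (ρ : P → ℕ) (T : Finset ℕ) : ℤ :=
  ∑ S ∈ T.powerset, (-1 : ℤ) ^ (T.card - S.card) * (alphaP P ρ S : ℤ)

/-- The `h`-polynomial `h(P,x) = Σ_{i=0}^n f_{i-1}(P) x^i (1-x)^{n-i}` of a (graded,
rank `n`) simplicial poset `P`, where `f_{i-1}(P)` is the number of elements of rank `i`. -/
def hpolyP (P : Type*) [Fintype P] [PartialOrder P] (ρ : P → ℕ) (n : ℕ) : Polynomial ℤ :=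
  ∑ i ∈ Finset.range (n + 1),
    C (((Finset.univ.filter (fun y : P => ρ y = i)).card : ℤ)) * X ^ i * (1 - X) ^ (n - i)

/-- chains of `P` whose set of ranks is `S` -/
def flags (P : Type*) [Fintype P] [PartialOrder P] (ρ : P → ℕ) (S : Finset ℕ) :
    Finset (Finset P) :=
  Finset.univ.filter (fun c => IsChain (· ≤ ·) (c : Set P) ∧ c.image ρ = S)

lemma mem_flags {P : Type*} [Fintype P] [PartialOrder P] {ρ : P → ℕ} {S : Finset ℕ}
    {c : Finset P} : c ∈ flags P ρ S ↔ IsChain (· ≤ ·) (c : Set P) ∧ c.image ρ = S := by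
  simp [flags]

lemma card_Icc_simp {P : Type*} [Fintype P] [PartialOrder P] [OrderBot P] {ρ : P → ℕ}
    (hs : ∀ y : P, Nonempty ((Set.Icc (⊥ : P) y) ≃o Finset (Fin (ρ y)))) (y : P) :
    (Set.Icc (⊥ : P) y).ncard = 2 ^ ρ y := by
  obtain ⟨e⟩ := hs y
  rw [← Nat.card_coe_set_eq, Nat.card_congr e.toEquiv]
  simp

lemma rank_strictMono {P : Type*} [Fintype P] [PartialOrder P] [OrderBot P] {ρ : P → ℕ}
    (hs : ∀ y : P, Nonempty ((Set.Icc (⊥ : P) y) ≃o Finset (Fin (ρ y)))) : StrictMono ρ := by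
  intro x y hxy
  have h : (Set.Icc (⊥ : P) x).ncard < (Set.Icc (⊥ : P) y).ncard := by
    apply Set.ncard_lt_ncard _ (Set.toFinite _)
    refine ⟨fun z hz => ⟨bot_le, hz.2.trans hxy.le⟩, fun h => ?_⟩
    exact absurd (h (⟨bot_le, le_rfl⟩ : y ∈ Set.Icc ⊥ y)).2 (not_le_of_gt hxy)
  rw [card_Icc_simp hs, card_Icc_simp hs] at h
  exact (Nat.pow_lt_pow_iff_right (by norm_num)).1 h

lemma chain_eq_of_rank {P : Type*} [Fintype P] [PartialOrder P] {ρ : P → ℕ}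
    (hρ : StrictMono ρ) {c : Set P} (hc : IsChain (· ≤ ·) c) {x y : P} (hx : x ∈ c) (hy : y ∈ c)
    (h : ρ x = ρ y) : x = y := by
  rcases hc.total hx hy with h1 | h1
  · rcases h1.eq_or_lt with h2 | h2
    · exact h2
    · have := hρ h2; omega
  · rcases h1.eq_or_lt with h2 | h2
    · exact h2.symm
    · have := hρ h2; omega

lemma chain_lt_of_rank {P : Type*} [Fintype P] [PartialOrder P] {ρ : P → ℕ}
    (hρ : StrictMono ρ) {c : Set P} (hc : IsChain (· ≤ ·) c) {x y : P} (hx : x ∈ c) (hy : y ∈ c)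
    (h : ρ x < ρ y) : x < y := by
  rcases hc.total hx hy with h1 | h1
  · rcases h1.eq_or_lt with h2 | h2
    · subst h2; omega
    · exact h2
  · have := hρ.monotone h1; omega

/-- chains strictly below `y` are counted in the Boolean lattice -/
lemma card_below {P : Type*} [Fintype P] [PartialOrder P] [OrderBot P] {ρ : P → ℕ}
    (hs : ∀ y : P, Nonempty ((Set.Icc (⊥ : P) y) ≃o Finset (Fin (ρ y))))
    (S : Finset ℕ) (m : ℕ) (hS : ∀ s ∈ S, s < m) (y : P) (hy : ρ y = m) :
    ((flags P ρ S).filter (fun c => ∀ x ∈ c, x < y)).card =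
      (flags (Finset (Fin m)) Finset.card S).card := by
  subst hy
  obtain ⟨e⟩ := hs y
  set g : Finset (Fin (ρ y)) → P := fun A => (e.symm A).1 with hg
  have hle : ∀ A B, g A ≤ g B ↔ A ≤ B := fun A B => by
    simp only [hg, Subtype.coe_le_coe, OrderIso.le_iff_le]
  have hinj : Function.Injective g := fun A B h =>
    le_antisymm ((hle _ _).1 h.le) ((hle _ _).1 h.ge)
  have hgy : ∀ A, g A ≤ y := fun A => (e.symm A).2.2
  have hsurj : ∀ x, x ≤ y → ∃ A, g A = x := fun x hx =>
    ⟨e ⟨x, bot_le, hx⟩, by simp [hg]⟩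
  have hrk : ∀ A, ρ (g A) = A.card := by
    intro A
    have h1 : Set.Icc ⊥ (g A) = g '' (A.powerset : Finset (Finset (Fin (ρ y)))) := by
      ext x
      simp only [Set.mem_Icc, bot_le, true_and, Set.mem_image, Finset.mem_coe,
        Finset.mem_powerset]
      constructor
      · intro hx
        obtain ⟨B, rfl⟩ := hsurj x (hx.trans (hgy A))
        exact ⟨B, (hle _ _).1 hx, rfl⟩
      · rintro ⟨B, hB, rfl⟩
        exact (hle _ _).2 hB
    have h2 := card_Icc_simp hs (g A)
    rw [h1, Set.ncard_image_of_injective _ hinj, Set.ncard_coe_finset, Finset.card_powerset] at h2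
    exact (Nat.pow_right_injective (le_refl 2) h2).symm
  symm
  apply Finset.card_bij (fun d _ => d.image g)
  · intro d hd
    rw [mem_flags] at hd
    rw [Finset.mem_filter, mem_flags]
    refine ⟨⟨?_, ?_⟩, ?_⟩
    · intro a ha b hb _
      simp only [Finset.coe_image, Set.mem_image, Finset.mem_coe] at ha hb
      obtain ⟨A, hA, rfl⟩ := ha
      obtain ⟨B, hB, rfl⟩ := hb
      simp only [hle]
      exact hd.1.total hA hB
    · rw [Finset.image_image, ← hd.2]
      apply Finset.image_congr
      intro A _
      exact hrk A
    · intro x hx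
      obtain ⟨A, hA, rfl⟩ := Finset.mem_image.1 hx
      refine lt_of_le_of_ne (hgy A) (fun h => ?_)
      have h1 := hS A.card (hd.2 ▸ Finset.mem_image_of_mem _ hA)
      rw [← hrk, h] at h1
      omega
  · intro a _ b _ h
    exact Finset.image_injective hinj h
  · intro c hc
    rw [Finset.mem_filter, mem_flags] at hc
    obtain ⟨⟨h1, h2⟩, h3⟩ := hc
    have key : (Finset.univ.filter (fun A => g A ∈ c)).image g = c := by
      ext x
      simp only [Finset.mem_image, Finset.mem_filter, Finset.mem_univ, true_and]
      constructor
      · rintro ⟨A, hA, rfl⟩; exact hA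
      · intro hx
        obtain ⟨A, rfl⟩ := hsurj x (h3 x hx).le
        exact ⟨A, hx, rfl⟩
    refine ⟨Finset.univ.filter (fun A => g A ∈ c), ?_, key⟩
    rw [mem_flags]
    refine ⟨?_, ?_⟩
    · intro A hA B hB _
      simp only [Finset.coe_filter, Finset.mem_univ, true_and, Set.mem_ofPred_eq] at hA hB
      simp only [← hle]
      exact h1.total hA hB
    · rw [← h2, ← key, Finset.image_image, key]
      apply Finset.image_congr
      intro A _
      exact (hrk A).symm

lemma card_flags_insert {P : Type*} [Fintype P] [PartialOrder P] [OrderBot P] {ρ : P → ℕ}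
    (hs : ∀ y : P, Nonempty ((Set.Icc (⊥ : P) y) ≃o Finset (Fin (ρ y))))
    (S : Finset ℕ) (m : ℕ) (hS : ∀ s ∈ S, s < m) (Q : P → Prop) :
    ((flags P ρ (insert m S)).filter (fun c => ∀ x ∈ c, ρ x = m → Q x)).card =
      (Finset.univ.filter (fun y : P => ρ y = m ∧ Q y)).card *
      (flags (Finset (Fin m)) Finset.card S).card := by
  have hρ := rank_strictMono hs
  have hsum : (Finset.univ.filter (fun y : P => ρ y = m ∧ Q y)).card *
      (flags (Finset (Fin m)) Finset.card S).card =
      ((Finset.univ.filter (fun y : P => ρ y = m ∧ Q y)).sigma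
        (fun y => (flags P ρ S).filter (fun c => ∀ x ∈ c, x < y))).card := by
    rw [Finset.card_sigma, Finset.sum_const_nat]
    intro y hy
    exact card_below hs S m hS y (Finset.mem_filter.1 hy).2.1
  rw [hsum]
  symm
  apply Finset.card_bij (fun p _ => insert p.1 p.2)
  · rintro ⟨y, c⟩ h
    simp only [Finset.mem_sigma, Finset.mem_filter, Finset.mem_univ, true_and, mem_flags] at h ⊢
    obtain ⟨⟨h1, h2⟩, ⟨h3, h4⟩, h5⟩ := h
    refine ⟨⟨?_, ?_⟩, ?_⟩
    · rw [Finset.coe_insert]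
      exact h3.insert (fun b hb _ => Or.inr (h5 b hb).le)
    · rw [Finset.image_insert, h1, h4]
    · intro x hx hxm
      rcases Finset.mem_insert.1 hx with rfl | hx
      · exact h2
      · have := hρ (h5 x hx); omega
  · rintro ⟨y, c⟩ h ⟨z, d⟩ h' heq
    simp only [Finset.mem_sigma, Finset.mem_filter, Finset.mem_univ, true_and, mem_flags] at h h' heq
    obtain ⟨⟨h1, h2⟩, ⟨h3, h4⟩, h5⟩ := h
    obtain ⟨⟨h1', h2'⟩, ⟨h3', h4'⟩, h5'⟩ := h'
    have hyz : y = z := by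
      have : y ∈ insert z d := heq ▸ Finset.mem_insert_self _ _
      rcases Finset.mem_insert.1 this with h | h
      · exact h
      · have := hρ (h5' _ h); omega
    subst hyz
    have hc : y ∉ c := fun h => lt_irrefl _ (h5 _ h)
    have hd : y ∉ d := fun h => lt_irrefl _ (h5' _ h)
    have : c = d := by rw [← Finset.erase_insert hc, heq, Finset.erase_insert hd]
    rw [this]
  · intro c hc
    simp only [Finset.mem_filter, mem_flags] at hc
    obtain ⟨⟨h1, h2⟩, h3⟩ := hc
    obtain ⟨y, hy, hym⟩ := Finset.mem_image.1 (h2 ▸ Finset.mem_insert_self m S : m ∈ c.image ρ)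
    refine ⟨⟨y, c.erase y⟩, ?_, Finset.insert_erase hy⟩
    have hlt : ∀ x ∈ c.erase y, ρ x ∈ S := by
      intro x hx
      have hxc := Finset.mem_of_mem_erase hx
      have h4 : ρ x ∈ insert m S := h2 ▸ Finset.mem_image_of_mem ρ hxc
      rcases Finset.mem_insert.1 h4 with h | h
      · exact absurd (chain_eq_of_rank hρ h1 hxc hy (h.trans hym.symm)) (Finset.ne_of_mem_erase hx)
      · exact h
    simp only [Finset.mem_sigma, Finset.mem_filter, Finset.mem_univ, true_and, mem_flags]
    refine ⟨⟨hym, h3 y hy hym⟩, ⟨h1.mono (by simp), ?_⟩, ?_⟩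
    · ext s
      constructor
      · intro h
        obtain ⟨x, hx, rfl⟩ := Finset.mem_image.1 h
        exact hlt x hx
      · intro h
        obtain ⟨x, hx, rfl⟩ := Finset.mem_image.1
          (h2 ▸ Finset.mem_insert_of_mem h : s ∈ c.image ρ)
        refine Finset.mem_image_of_mem _ (Finset.mem_erase.2 ⟨?_, hx⟩)
        rintro rfl
        have := hS _ h; omega
    · intro x hx
      apply chain_lt_of_rank hρ h1 (Finset.mem_of_mem_erase hx) hy
      have := hS _ (hlt x hx); omega

lemma finset_simp {N : ℕ} (B : Finset (Fin N)) :
    Nonempty ((Set.Icc (⊥ : Finset (Fin N)) B) ≃o Finset (Fin B.card)) := by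
  let e := B.equivFin
  have hval : ∀ (C : Finset (Fin N)), C ≤ B → ∀ x ∈ C, ∃ i : Fin B.card, ((e.symm i : B) : Fin N) = x :=
    fun C hC x hx => ⟨e ⟨x, hC hx⟩, by simp⟩
  refine ⟨⟨⟨fun C => Finset.univ.filter (fun i => ((e.symm i : B) : Fin N) ∈ C.1),
    fun D => ⟨D.image (fun i => ((e.symm i : B) : Fin N)), bot_le, ?_⟩, ?_, ?_⟩, ?_⟩⟩
  · intro x hx
    obtain ⟨i, _, rfl⟩ := Finset.mem_image.1 hx
    exact (e.symm i).2
  · rintro ⟨C, hC⟩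
    apply Subtype.ext
    ext x
    simp only [Finset.mem_image, Finset.mem_filter, Finset.mem_univ, true_and]
    constructor
    · rintro ⟨i, hi, rfl⟩; exact hi
    · intro hx
      obtain ⟨i, rfl⟩ := hval C hC.2 x hx
      exact ⟨i, hx, rfl⟩
  · intro D
    ext i
    simp only [Finset.mem_image, Finset.mem_filter, Finset.mem_univ, true_and]
    constructor
    · rintro ⟨j, hj, h⟩
      have := e.symm.injective (Subtype.ext h)
      exact this ▸ hj
    · intro h; exact ⟨i, h, rfl⟩
  · rintro ⟨C, hC⟩ ⟨D, hD⟩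
    constructor
    · intro h x hx
      obtain ⟨i, rfl⟩ := hval C hC.2 x hx
      have := @h i (by simpa using hx)
      simpa using this
    · intro h i hi
      simp only [Equiv.coe_fn_mk, Finset.mem_filter, Finset.mem_univ, true_and] at hi ⊢
      exact h hi

lemma exists_rank_between {P : Type*} [Fintype P] [PartialOrder P] {ρ : P → ℕ}
    (hcov : ∀ x y : P, x ⋖ y → ρ y = ρ x + 1) {x z : P} (hxz : x ≤ z) {s : ℕ}
    (h1 : ρ x ≤ s) (h2 : s ≤ ρ z) : ∃ y, x ≤ y ∧ y ≤ z ∧ ρ y = s := by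
  obtain ⟨y, hy⟩ := (Set.toFinite {y : P | x ≤ y ∧ y ≤ z ∧ ρ y ≤ s}).exists_maximal
    ⟨x, le_rfl, hxz, h1⟩
  obtain ⟨hxy, hyz, hys⟩ := hy.prop
  refine ⟨y, hxy, hyz, le_antisymm hys ?_⟩
  by_contra hlt
  have hlt' : y < z := lt_of_le_of_ne hyz (by rintro rfl; omega)
  obtain ⟨w, hyw, hwz⟩ := exists_covBy_le_of_lt hlt'
  have hr := hcov _ _ hyw
  have := hy.le_of_ge (⟨hxy.trans hyw.le, hwz, by omega⟩ : w ∈ {y : P | x ≤ y ∧ y ≤ z ∧ ρ y ≤ s})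
    hyw.le
  exact absurd hyw.lt (not_lt_of_ge this)

lemma maxChain_has_rank {P : Type*} [Fintype P] [PartialOrder P] [OrderBot P] {n : ℕ}
    {ρ : P → ℕ} (hρ : StrictMono ρ)
    (hbot : ρ ⊥ = 0) (hcov : ∀ x y : P, x ⋖ y → ρ y = ρ x + 1)
    (hmax : ∀ x : P, IsMax x → ρ x = n) (S : Finset ℕ) (hS : S ⊆ Finset.Icc 1 n)
    {C : Set (rankSel P ρ S)} (hC : IsMaxChain (· ≤ ·) C) {s : ℕ} (hs : s ∈ S) :
    ∃ z ∈ C, ∃ y : P, z.1 = (y : WithTop P) ∧ ρ y = s := by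
  by_contra hno
  push Not at hno
  have hs1 := Finset.mem_Icc.1 (hS hs)
  have hcomp : ∀ a b : P, (∃ z ∈ C, z.1 = (a : WithTop P)) → (∃ z ∈ C, z.1 = (b : WithTop P)) →
      a ≤ b ∨ b ≤ a := by
    rintro a b ⟨z, hz, hza⟩ ⟨w, hw, hwb⟩
    rcases hC.1.total hz hw with h | h
    · left; have h' : z.1 ≤ w.1 := h
      rw [hza, hwb] at h'; exact WithTop.coe_le_coe.1 h'
    · right; have h' : w.1 ≤ z.1 := h
      rw [hza, hwb] at h'; exact WithTop.coe_le_coe.1 h'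
  let L : Set P := {a | (a = ⊥ ∨ ∃ z ∈ C, z.1 = (a : WithTop P)) ∧ ρ a < s}
  obtain ⟨x, hx⟩ := (Set.toFinite L).exists_maximal ⟨⊥, Or.inl rfl, by omega⟩
  have hxL : ∀ a ∈ L, a ≤ x := by
    intro a ha
    have : a ≤ x ∨ x ≤ a := by
      rcases ha.1 with h | h
      · left; rw [h]; exact bot_le
      · rcases hx.prop.1 with h' | h'
        · right; rw [h']; exact bot_le
        · exact hcomp _ _ h h'
    rcases this with h | h
    · exact h
    · exact hx.le_of_ge ha h
  let U : Set P := {a | (∃ z ∈ C, z.1 = (a : WithTop P)) ∧ s < ρ a}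
  have hU : ∃ u, x ≤ u ∧ s ≤ ρ u ∧ ∀ a ∈ U, u ≤ a := by
    by_cases hne : U.Nonempty
    · obtain ⟨u, hu⟩ := (Set.toFinite U).exists_minimal hne
      refine ⟨u, ?_, hu.prop.2.le, ?_⟩
      · rcases hx.prop.1 with h | h
        · rw [h]; exact bot_le
        · rcases hcomp _ _ h hu.prop.1 with h' | h'
          · exact h'
          · have := hρ.monotone h'
            have := hx.prop.2
            have := hu.prop.2
            omega
      · intro a ha
        rcases hcomp _ _ ha.1 hu.prop.1 with h | h
        · exact hu.le_of_le ha h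
        · exact h
    · obtain ⟨u, hxu, hu⟩ := Finite.exists_le_maximal (p := fun _ : P => True) (a := x) trivial
      have hu' : IsMax u := fun b hb => hu.2 trivial hb
      refine ⟨u, hxu, by rw [hmax u hu']; exact hs1.2, ?_⟩
      intro a ha
      exact absurd ⟨a, ha⟩ hne
  obtain ⟨u, hxu, hsu, huU⟩ := hU
  obtain ⟨y, hxy, hyu, hys⟩ := exists_rank_between hcov hxu hx.prop.2.le hsu
  let Y : rankSel P ρ S := ⟨(y : WithTop P), Or.inr (Or.inr ⟨y, rfl, hys ▸ hs⟩)⟩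
  have hchain : IsChain (· ≤ ·) (insert Y C) := by
    apply hC.1.insert
    rintro ⟨b, hb⟩ hbC _
    rcases b with _ | b
    · left; exact (le_top : (y : WithTop P) ≤ ⊤)
    · have hne : ρ b ≠ s := hno _ hbC b rfl
      rcases lt_or_gt_of_ne hne with h | h
      · right
        exact WithTop.coe_le_coe.2 ((hxL b ⟨Or.inr ⟨_, hbC, rfl⟩, h⟩).trans hxy)
      · left
        exact WithTop.coe_le_coe.2 (hyu.trans (huU b ⟨⟨_, hbC, rfl⟩, h⟩))
  have heq := hC.2 hchain (Set.subset_insert _ _)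
  have hYC : Y ∈ C := heq ▸ Set.mem_insert _ _
  exact hno Y hYC y rfl hys

lemma alphaP_eq {P : Type*} [Fintype P] [PartialOrder P] [OrderBot P] {n : ℕ}
    {ρ : P → ℕ} (hρ : StrictMono ρ)
    (hbot : ρ ⊥ = 0) (hcov : ∀ x y : P, x ⋖ y → ρ y = ρ x + 1)
    (hmax : ∀ x : P, IsMax x → ρ x = n) (S : Finset ℕ) (hS : S ⊆ Finset.Icc 1 n) :
    alphaP P ρ S = (flags P ρ S).card := by
  unfold alphaP
  rw [← Set.ncard_coe_finset]
  have h0 : 0 ∉ S := fun h => by have := Finset.mem_Icc.1 (hS h); omega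
  let F : Set (rankSel P ρ S) → Finset P := fun C =>
    Finset.univ.filter (fun y => ρ y ∈ S ∧ ∃ z ∈ C, z.1 = (y : WithTop P))
  have hF : ∀ C y, y ∈ F C ↔ ρ y ∈ S ∧ ∃ z ∈ C, z.1 = (y : WithTop P) := by
    intro C y; simp [F]
  have hext : ∀ C : Set (rankSel P ρ S), IsMaxChain (· ≤ ·) C → ∀ z : rankSel P ρ S,
      (z.1 = ⊤ ∨ z.1 = ((⊥ : P) : WithTop P)) → z ∈ C := by
    intro C hC z hz
    have hchain : IsChain (· ≤ ·) (insert z C) := by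
      apply hC.1.insert
      intro b hb _
      rcases hz with h | h
      · right; show b.1 ≤ z.1; rw [h]; exact le_top
      · left; show z.1 ≤ b.1; rw [h]; exact bot_le
    rw [hC.2 hchain (Set.subset_insert _ _)]
    exact Set.mem_insert _ _
  apply Set.ncard_congr (fun C _ => F C)
  · intro C hC
    have hC' : IsMaxChain (· ≤ ·) C := hC
    rw [Finset.mem_coe, mem_flags]
    constructor
    · intro a ha b hb _
      obtain ⟨_, z, hz, hza⟩ := (hF _ _).1 ha
      obtain ⟨_, w, hw, hwb⟩ := (hF _ _).1 hb
      rcases hC'.1.total hz hw with h | h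
      · left; have h' : z.1 ≤ w.1 := h
        rw [hza, hwb] at h'; exact WithTop.coe_le_coe.1 h'
      · right; have h' : w.1 ≤ z.1 := h
        rw [hza, hwb] at h'; exact WithTop.coe_le_coe.1 h'
    · ext s
      constructor
      · intro h
        obtain ⟨y, hy, rfl⟩ := Finset.mem_image.1 h
        exact ((hF _ _).1 hy).1
      · intro h
        obtain ⟨z, hz, y, hzy, rfl⟩ := maxChain_has_rank hρ hbot hcov hmax S hS hC' h
        exact Finset.mem_image_of_mem _ ((hF _ _).2 ⟨h, z, hz, hzy⟩)
  · have hsub : ∀ C D : Set (rankSel P ρ S), IsMaxChain (· ≤ ·) C → IsMaxChain (· ≤ ·) D →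
        F C = F D → C ⊆ D := by
      intro C D hC hD h z hz
      rcases z.2 with h1 | h1 | ⟨y, hy, hyS⟩
      · exact hext D hD z (Or.inl h1)
      · exact hext D hD z (Or.inr h1)
      · have : y ∈ F D := h ▸ (hF C y).2 ⟨hyS, z, hz, hy⟩
        obtain ⟨_, w, hw, hwy⟩ := (hF _ _).1 this
        have : z = w := Subtype.ext (hy.trans hwy.symm)
        exact this ▸ hw
    intro C D hC hD h
    exact Set.Subset.antisymm (hsub C D hC hD h) (hsub D C hD hC h.symm)
  · intro c hc
    rw [Finset.mem_coe, mem_flags] at hc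
    obtain ⟨h1, h2⟩ := hc
    let C : Set (rankSel P ρ S) := {z | z.1 = ⊤ ∨ z.1 = ((⊥ : P) : WithTop P) ∨
      ∃ y ∈ c, z.1 = (y : WithTop P)}
    refine ⟨C, ⟨?_, ?_⟩, ?_⟩
    · intro a ha b hb _
      show a.1 ≤ b.1 ∨ b.1 ≤ a.1
      rcases ha with ha | ha | ⟨y, hy, ha⟩
      · right; rw [ha]; exact le_top
      · left; rw [ha]; exact bot_le
      · rcases hb with hb | hb | ⟨w, hw, hb⟩
        · left; rw [hb]; exact le_top
        · right; rw [hb]; exact bot_le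
        · rw [ha, hb, WithTop.coe_le_coe, WithTop.coe_le_coe]
          exact h1.total hy hw
    · intro D hD hCD
      refine Set.Subset.antisymm hCD ?_
      intro z hz
      rcases z.2 with h3 | h3 | ⟨y, hy, hyS⟩
      · exact Or.inl h3
      · exact Or.inr (Or.inl h3)
      · rw [← h2] at hyS
        obtain ⟨w, hw, hwy⟩ := Finset.mem_image.1 hyS
        let W : rankSel P ρ S := ⟨(w : WithTop P), Or.inr (Or.inr ⟨w, rfl, by
          rw [← h2]; exact Finset.mem_image_of_mem _ hw⟩)⟩
        have hWD : W ∈ D := hCD (Or.inr (Or.inr ⟨w, hw, rfl⟩))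
        have hcmp : w ≤ y ∨ y ≤ w := by
          rcases hD.total hWD hz with h | h
          · left; have h' : W.1 ≤ z.1 := h
            rw [hy] at h'; exact WithTop.coe_le_coe.1 h'
          · right; have h' : z.1 ≤ W.1 := h
            rw [hy] at h'; exact WithTop.coe_le_coe.1 h'
        have hwy' : w = y := by
          rcases hcmp with h | h
          · rcases h.eq_or_lt with h | h
            · exact h
            · have := hρ h; omega
          · rcases h.eq_or_lt with h | h
            · exact h.symm
            · have := hρ h; omega
        exact Or.inr (Or.inr ⟨y, hwy' ▸ hw, hy⟩)
    · ext y
      rw [hF]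
      constructor
      · rintro ⟨hyS, z, hz, hzy⟩
        rcases hz with h | h | ⟨w, hw, h⟩
        · rw [hzy] at h; exact absurd h (WithTop.coe_ne_top)
        · rw [hzy] at h
          have := WithTop.coe_injective h
          subst this
          rw [hbot] at hyS
          exact absurd hyS h0
        · rw [hzy] at h
          have := WithTop.coe_injective h
          exact this ▸ hw
      · intro hy
        have hyS : ρ y ∈ S := by rw [← h2]; exact Finset.mem_image_of_mem _ hy
        exact ⟨hyS, ⟨(y : WithTop P), Or.inr (Or.inr ⟨y, rfl, hyS⟩)⟩,
          Or.inr (Or.inr ⟨y, hy, rfl⟩), rfl⟩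

lemma reflect_one_sub_pow (j : ℕ) :
    Polynomial.reflect j ((1 - X : Polynomial ℤ) ^ j) = (X - 1) ^ j := by
  have hd : (1 - X : Polynomial ℤ).natDegree ≤ 1 := by
    refine (natDegree_sub_le _ _).trans ?_
    simp
  induction j with
  | zero => simp
  | succ j ih =>
    rw [pow_succ, Polynomial.reflect_mul _ _ (natDegree_pow_le_of_le j hd |>.trans (by simp)) hd, ih,
      pow_succ]
    congr 1
    have h1 := Polynomial.reflect_monomial (R := ℤ) 1 0
    have h2 := Polynomial.reflect_monomial (R := ℤ) 1 1
    rw [Polynomial.revAt_le (by norm_num)] at h1 h2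
    simp only [pow_zero, pow_one, Nat.sub_zero, Nat.sub_self] at h1 h2
    rw [Polynomial.reflect_sub, h1, h2]

lemma f_of_h (n m : ℕ) (hm : m ≤ n) (f : ℕ → ℤ) :
    ∑ k ∈ Finset.range (n + 1), (∑ i ∈ Finset.range (n + 1),
      C (f i) * X ^ i * (1 - X) ^ (n - i) : Polynomial ℤ).coeff k * ((n - k).choose (n - m) : ℤ)
      = f m := by
  set p : Polynomial ℤ := ∑ i ∈ Finset.range (n + 1), C (f i) * X ^ i * (1 - X) ^ (n - i) with hp
  have hr : Polynomial.reflect n p = ∑ i ∈ Finset.range (n + 1), C (f i) * (X - 1) ^ (n - i) := by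
    have : ∀ s : Finset ℕ, s ⊆ Finset.range (n + 1) → Polynomial.reflect n
        (∑ i ∈ s, C (f i) * X ^ i * (1 - X) ^ (n - i)) = ∑ i ∈ s, C (f i) * (X - 1) ^ (n - i) := by
      intro s
      induction s using Finset.induction_on with
      | empty => simp
      | insert a s ha ih =>
        intro hs
        have han : a ≤ n := by
          have := Finset.mem_range.1 (hs (Finset.mem_insert_self _ _)); omega
        rw [Finset.sum_insert ha, Finset.sum_insert ha, Polynomial.reflect_add,
          ih (fun x hx => hs (Finset.mem_insert_of_mem hx)), mul_assoc, Polynomial.reflect_C_mul]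
        congr 2
        have hd : ((1 - X : Polynomial ℤ) ^ (n - a)).natDegree ≤ n - a := by
          refine (natDegree_pow_le_of_le (n - a) (m := 1) ?_).trans (by simp)
          refine (natDegree_sub_le _ _).trans ?_
          simp
        have h := Polynomial.reflect_mul (X ^ a : Polynomial ℤ) ((1 - X) ^ (n - a)) (F := a)
          (G := n - a) (by simp) hd
        rw [Nat.add_sub_cancel' han, reflect_one_sub_pow] at h
        rw [h, Polynomial.reflect_monomial]
        simp [Polynomial.revAt_le]
    exact this _ subset_rfl
  have hdeg : (Polynomial.reflect n p).natDegree < n + 1 := by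
    rw [hr, Nat.lt_succ_iff]
    refine natDegree_sum_le_of_forall_le _ _ (fun i hi => ?_)
    refine (natDegree_C_mul_le _ _).trans ?_
    refine (natDegree_pow_le_of_le (n - i) (m := 1) ?_).trans (by omega)
    refine (natDegree_sub_le _ _).trans ?_
    simp
  have hc : ((Polynomial.reflect n p).comp (X + 1)).coeff (n - m) = f m := by
    rw [hr]
    simp only [Polynomial.sum_comp, mul_comp, C_comp, pow_comp, sub_comp, X_comp, one_comp,
      add_sub_cancel_right, finsetSum_coeff, coeff_C_mul, coeff_X_pow]
    rw [Finset.sum_eq_single m]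
    · simp
    · intro b hb hbm
      have := Finset.mem_range.1 hb
      rw [if_neg (by omega)]; simp
    · intro h; exact absurd (Finset.mem_range.2 (by omega)) h
  rw [← hc]
  rw [Polynomial.comp, Polynomial.eval₂_eq_sum_range' _ hdeg]
  rw [finsetSum_coeff, ← Finset.sum_range_reflect]
  apply Finset.sum_congr rfl
  intro k hk
  have hk' := Finset.mem_range.1 hk
  rw [coeff_C_mul, Polynomial.coeff_X_add_one_pow, Polynomial.coeff_reflect, Polynomial.revAt_le (by omega)]
  have e1 : n + 1 - 1 - k = n - k := by omega
  have e2 : n - (n - k) = k := by omega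
  rw [e1, e2]

lemma mem_descSet {n : ℕ} (w : Equiv.Perm (Fin (n + 1))) (j : ℕ) :
    j ∈ descSet w ↔ ∃ (i : ℕ) (h : i + 1 < n + 1), j = i + 1 ∧
      w ⟨i + 1, h⟩ < w ⟨i, by omega⟩ := by
  unfold descSet
  simp only [Finset.mem_image, Finset.mem_filter, Finset.mem_univ, true_and]
  constructor
  · rintro ⟨i, hi, rfl⟩
    exact ⟨i.1, by have := i.2; omega, rfl, hi⟩
  · rintro ⟨i, h, rfl, hi⟩
    exact ⟨⟨i, by omega⟩, hi, rfl⟩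

lemma descSet_subset {n : ℕ} (w : Equiv.Perm (Fin (n + 1))) : descSet w ⊆ Finset.Icc 1 n := by
  intro j hj
  obtain ⟨i, h, rfl, _⟩ := (mem_descSet w j).1 hj
  rw [Finset.mem_Icc]; omega

lemma lt_of_no_desc {n : ℕ} (w : Equiv.Perm (Fin (n + 1))) (i : Fin (n + 1)) :
    ∀ (j : ℕ) (hj : j < n + 1), i.1 < j → (∀ t, i.1 < t → t ≤ j → t ∉ descSet w) →
      w i < w ⟨j, hj⟩ := by
  intro j
  induction j with
  | zero => intro _ h; omega
  | succ j ih =>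
    intro hj hij hno
    have hstep : w ⟨j, by omega⟩ < w ⟨j + 1, hj⟩ := by
      have h := hno (j + 1) hij le_rfl
      rw [mem_descSet] at h
      push Not at h
      have h' := h j hj rfl
      refine lt_of_le_of_ne h' (fun h => ?_)
      have := w.injective h
      simp at this
    rcases Nat.lt_or_ge i.1 j with h | h
    · exact (ih (by omega) h (fun t h1 h2 => hno t h1 (by omega))).trans hstep
    · have : i = ⟨j, by omega⟩ := Fin.ext (by simp; omega)
      rw [this]; exact hstep

/-- image of the last `s` positions -/
def tailSet {n : ℕ} (w : Equiv.Perm (Fin (n + 1))) (s : ℕ) : Finset (Fin (n + 1)) :=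
  Finset.univ.filter (fun a => n + 1 - s ≤ (w.symm a).1)

lemma mem_tailSet {n : ℕ} (w : Equiv.Perm (Fin (n + 1))) (s : ℕ) (a : Fin (n + 1)) :
    a ∈ tailSet w s ↔ n + 1 - s ≤ (w.symm a).1 := by simp [tailSet]

lemma card_tailSet {n : ℕ} (w : Equiv.Perm (Fin (n + 1))) (s : ℕ) (h1 : 1 ≤ s) (h2 : s ≤ n + 1) :
    (tailSet w s).card = s := by
  have : tailSet w s = (Finset.Ici (⟨n + 1 - s, by omega⟩ : Fin (n + 1))).map w.toEmbedding := by
    ext a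
    rw [mem_tailSet]
    simp [Finset.mem_map_equiv, Fin.le_def]
  rw [this, Finset.card_map, Fin.card_Ici]
  simp; omega

/-- number of members containing `a` -/
def level {N : ℕ} (c : Finset (Finset (Fin N))) (a : Fin N) : ℕ :=
  (c.filter (fun B => a ∈ B)).card

lemma upper_mem {N s : ℕ} (U : Finset (Fin N)) (hU : ∀ i ∈ U, ∀ j, i ≤ j → j ∈ U)
    (hs : U.card = s) (i : Fin N) : i ∈ U ↔ N - s ≤ i.1 := by
  constructor
  · intro hi
    have h : Finset.Ici i ⊆ U := fun j hj => hU i hi j (Finset.mem_Ici.1 hj)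
    have := Finset.card_le_card h
    rw [Fin.card_Ici] at this
    omega
  · intro h
    by_contra hi
    have h' : U ⊆ Finset.Ioi i := by
      intro j hj
      rw [Finset.mem_Ioi]
      by_contra hji
      exact hi (hU j hj i (not_lt.1 hji))
    have := Finset.card_le_card h'
    rw [Fin.card_Ioi] at this
    have := i.2
    omega

lemma level_lt {N : ℕ} {c : Finset (Finset (Fin N))} (hc : IsChain (· ≤ ·) (c : Set (Finset (Fin N))))
    {B : Finset (Fin N)} (hB : B ∈ c) {a b : Fin N} (ha : a ∈ B) (hb : b ∉ B) :
    level c b < level c a := by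
  apply Finset.card_lt_card
  refine ⟨?_, ?_⟩
  · intro C hC
    rw [Finset.mem_filter] at hC ⊢
    refine ⟨hC.1, ?_⟩
    rcases hc.total hC.1 hB with h | h
    · exact absurd (h hC.2) hb
    · exact h ha
  · intro h
    exact hb (Finset.mem_filter.1 (h (Finset.mem_filter.2 ⟨hB, ha⟩))).2

lemma eq_tailSet {n : ℕ} {c : Finset (Finset (Fin (n + 1)))}
    (hc : IsChain (· ≤ ·) (c : Set (Finset (Fin (n + 1)))))
    {B : Finset (Fin (n + 1))} (hB : B ∈ c) :
    tailSet (Tuple.sort (level c)) B.card = B := by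
  set w := Tuple.sort (level c) with hw
  have hmono : Monotone (level c ∘ w) := Tuple.monotone_sort _
  have key := upper_mem (s := B.card) (B.map w.symm.toEmbedding) (by
    intro i hi j hij
    rw [Finset.mem_map_equiv] at hi ⊢
    simp only [Equiv.symm_symm] at hi ⊢
    by_contra hj
    have h1 := level_lt hc hB hi hj
    have h2 := hmono hij
    simp only [Function.comp] at h2
    omega) (by simp)
  ext a
  rw [mem_tailSet, ← key, Finset.mem_map_equiv]
  simp

lemma perm_count (n : ℕ) (S : Finset ℕ) (hS : S ⊆ Finset.Icc 1 n) (k : Fin (n + 1)) :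
    (Finset.univ.filter (fun w : Equiv.Perm (Fin (n + 1)) =>
      w 0 = k ∧ descSet w ⊆ S.image (fun a => n + 1 - a))).card =
    ((flags (Finset (Fin (n + 1))) Finset.card S).filter (fun c =>
      (∀ B ∈ c, k ∉ B) ∧ ∀ a < k, ∃ B ∈ c, a ∈ B)).card := by
  have hS' : ∀ s ∈ S, 1 ≤ s ∧ s ≤ n := fun s hs => Finset.mem_Icc.1 (hS hs)
  apply Finset.card_nbij' (fun w => S.image (tailSet w)) (fun c => Tuple.sort (level c))
  · intro w hw
    simp only [Finset.coe_filter, Finset.mem_univ, true_and, Set.mem_ofPred_eq, mem_flags] at hw ⊢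
    obtain ⟨hw0, hdes⟩ := hw
    refine ⟨⟨?_, ?_⟩, ?_, ?_⟩
    · intro A hA B hB _
      simp only [Finset.coe_image, Set.mem_image, Finset.mem_coe] at hA hB
      obtain ⟨s, hs, rfl⟩ := hA
      obtain ⟨t, ht, rfl⟩ := hB
      rcases le_total s t with h | h
      · left; intro a ha; rw [mem_tailSet] at ha ⊢; omega
      · right; intro a ha; rw [mem_tailSet] at ha ⊢; omega
    · rw [Finset.image_image]
      conv_rhs => rw [← Finset.image_id (s := S)]
      apply Finset.image_congr
      intro s hs
      have := hS' s hs
      exact card_tailSet w s this.1 (by omega)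
    · intro B hB
      obtain ⟨s, hs, rfl⟩ := Finset.mem_image.1 hB
      have := hS' s hs
      rw [mem_tailSet, ← hw0]
      simp; omega
    · intro a ha
      by_contra hno
      push Not at hno
      have hpos : 0 < (w.symm a).1 := by
        rcases Nat.eq_zero_or_pos (w.symm a).1 with h | h
        · have h' : w.symm a = 0 := Fin.ext h
          rw [Equiv.symm_apply_eq] at h'
          rw [h', hw0] at ha
          exact absurd ha (lt_irrefl _)
        · exact h
      have := lt_of_no_desc w 0 (w.symm a).1 (w.symm a).2 hpos (by
        intro t _ ht htd
        obtain ⟨s, hs, rfl⟩ := Finset.mem_image.1 (hdes htd)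
        exact hno _ (Finset.mem_image_of_mem _ hs) ((mem_tailSet _ _ _).2 ht))
      simp only [Fin.eta, Equiv.apply_symm_apply, hw0] at this
      exact absurd ha (not_lt_of_gt this)
  · intro c hc
    simp only [Finset.coe_filter, Finset.mem_univ, true_and, Set.mem_ofPred_eq, mem_flags] at hc ⊢
    obtain ⟨⟨h1, h2⟩, h3, h4⟩ := hc
    obtain ⟨hmono, htie⟩ := Tuple.eq_sort_iff.1 (rfl : Tuple.sort (level c) = _)
    have htail := fun B (hB : B ∈ c) => eq_tailSet h1 hB
    set w := Tuple.sort (level c) with hw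
    constructor
    · have hk0 : level c k = 0 := by
        unfold level
        rw [Finset.card_eq_zero, Finset.filter_eq_empty_iff]
        exact h3
      have hw0 : level c (w 0) = 0 := by
        have h5 := hmono (Fin.zero_le (w.symm k))
        simp only [Function.comp, Equiv.apply_symm_apply] at h5
        omega
      have hge : k ≤ w 0 := by
        by_contra hlt
        obtain ⟨B, hB, hB'⟩ := h4 _ (not_le.1 hlt)
        unfold level at hw0
        rw [Finset.card_eq_zero, Finset.filter_eq_empty_iff] at hw0
        exact hw0 hB hB'
      by_contra hne
      have hpos : 0 < w.symm k := by
        rw [Fin.pos_iff_ne_zero]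
        intro h
        rw [Equiv.symm_apply_eq] at h
        exact hne h.symm
      have := htie 0 (w.symm k) hpos (by simp [hw0, hk0])
      simp only [Equiv.apply_symm_apply] at this
      exact absurd hge (not_le_of_gt this)
    · intro j hj
      obtain ⟨i, hi, rfl, hd⟩ := (mem_descSet w j).1 hj
      have hex : ∃ B ∈ c, w ⟨i + 1, hi⟩ ∈ B ∧ w ⟨i, by omega⟩ ∉ B := by
        by_contra hno
        push Not at hno
        have hle : level c (w ⟨i + 1, hi⟩) ≤ level c (w ⟨i, by omega⟩) := by
          apply Finset.card_le_card
          intro B hB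
          rw [Finset.mem_filter] at hB ⊢
          exact ⟨hB.1, hno B hB.1 hB.2⟩
        have hlt : (⟨i, by omega⟩ : Fin (n + 1)) < ⟨i + 1, hi⟩ := by simp [Fin.lt_def]
        have hge := hmono hlt.le
        simp only [Function.comp] at hge
        exact absurd hd (not_lt_of_gt (htie _ _ hlt (le_antisymm hge hle)))
      obtain ⟨B, hB, hB1, hB2⟩ := hex
      rw [← htail B hB, mem_tailSet] at hB1 hB2
      simp only [Equiv.symm_apply_apply] at hB1 hB2
      have : B.card ∈ S := h2 ▸ Finset.mem_image_of_mem _ hB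
      refine Finset.mem_image.2 ⟨B.card, this, by omega⟩
  · intro w hw
    simp only [Finset.coe_filter, Finset.mem_univ, true_and, Set.mem_ofPred_eq] at hw
    obtain ⟨hw0, hdes⟩ := hw
    symm
    rw [Tuple.eq_sort_iff]
    have hsub : ∀ i j : Fin (n + 1), i ≤ j →
        (S.image (tailSet w)).filter (fun B => w i ∈ B) ⊆
        (S.image (tailSet w)).filter (fun B => w j ∈ B) := by
      intro i j hij B hB
      rw [Finset.mem_filter] at hB ⊢
      refine ⟨hB.1, ?_⟩
      obtain ⟨s, hs, rfl⟩ := Finset.mem_image.1 hB.1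
      have h := hB.2
      rw [mem_tailSet] at h ⊢
      simp only [Equiv.symm_apply_apply] at h ⊢
      have := Fin.le_def.1 hij
      omega
    constructor
    · intro i j hij
      exact Finset.card_le_card (hsub i j hij)
    · intro i j hij heq
      have hset := Finset.eq_of_subset_of_card_le (hsub i j hij.le) heq.ge
      have := lt_of_no_desc w i j.1 j.2 hij (by
        intro t ht1 ht2 htd
        obtain ⟨s, hs, rfl⟩ := Finset.mem_image.1 (hdes htd)
        have h5 : tailSet w s ∈ (S.image (tailSet w)).filter (fun B => w j ∈ B) := by
          rw [Finset.mem_filter]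
          refine ⟨Finset.mem_image_of_mem _ hs, ?_⟩
          rw [mem_tailSet]; simpa using ht2
        rw [← hset, Finset.mem_filter, mem_tailSet] at h5
        have h6 := h5.2
        simp only [Equiv.symm_apply_apply] at h6
        omega)
      exact this
  · intro c hc
    simp only [Finset.coe_filter, Set.mem_ofPred_eq, mem_flags] at hc
    obtain ⟨⟨h1, h2⟩, _⟩ := hc
    show S.image (tailSet (Tuple.sort (level c))) = c
    rw [← h2, Finset.image_image]
    conv_rhs => rw [← Finset.image_id (s := c)]
    apply Finset.image_congr
    intro B hB
    exact eq_tailSet h1 hB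

lemma count_tops (n m : ℕ) (hm : m ≤ n) (k : Fin (n + 1)) :
    (Finset.univ.filter (fun B : Finset (Fin (n + 1)) =>
      B.card = m ∧ (k ∉ B ∧ ∀ a < k, a ∈ B))).card = (n - k.1).choose (n - m) := by
  have : (n - k.1).choose (n - m) = (Finset.powersetCard (n - m) (Finset.Ioi k)).card := by
    rw [Finset.card_powersetCard, Fin.card_Ioi]; congr 1
  rw [this]
  apply Finset.card_nbij' (fun B => Bᶜ.erase k) (fun D => (insert k D)ᶜ)
  · intro B hB
    simp only [Finset.coe_filter, Finset.mem_univ, true_and, Set.mem_ofPred_eq] at hB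
    obtain ⟨h1, h2, h3⟩ := hB
    rw [Finset.mem_coe, Finset.mem_powersetCard]
    constructor
    · intro a ha
      simp only [Finset.mem_erase, Finset.mem_compl] at ha
      rw [Finset.mem_Ioi]
      by_contra h
      exact ha.2 (h3 a (lt_of_le_of_ne (not_lt.1 h) ha.1))
    · rw [Finset.card_erase_of_mem (by simpa using h2), Finset.card_compl, h1, Fintype.card_fin]
      omega
  · intro D hD
    rw [Finset.mem_coe, Finset.mem_powersetCard] at hD
    obtain ⟨h1, h2⟩ := hD
    have hk : k ∉ D := fun h => lt_irrefl _ (Finset.mem_Ioi.1 (h1 h))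
    simp only [Finset.coe_filter, Finset.mem_univ, true_and, Set.mem_ofPred_eq]
    refine ⟨?_, by simp, ?_⟩
    · rw [Finset.card_compl, Finset.card_insert_of_notMem hk, h2, Fintype.card_fin]; omega
    · intro a ha
      simp only [Finset.mem_compl, Finset.mem_insert, not_or]
      exact ⟨ha.ne, fun h => absurd ha (not_lt_of_gt (Finset.mem_Ioi.1 (h1 h)))⟩
  · intro B hB
    simp only [Finset.coe_filter, Finset.mem_univ, true_and, Set.mem_ofPred_eq] at hB
    obtain ⟨h1, h2, h3⟩ := hB
    show (insert k (Bᶜ.erase k))ᶜ = B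
    rw [Finset.insert_erase (by simpa using h2), compl_compl]
  · intro D hD
    rw [Finset.mem_coe, Finset.mem_powersetCard] at hD
    obtain ⟨h1, h2⟩ := hD
    have hk : k ∉ D := fun h => lt_irrefl _ (Finset.mem_Ioi.1 (h1 h))
    show (((insert k D)ᶜ)ᶜ).erase k = D
    rw [compl_compl, Finset.erase_insert hk]

lemma count_formula {n : ℕ} {P : Type*} [Fintype P] [PartialOrder P] [OrderBot P]
    {ρ : P → ℕ} (hbot : ρ ⊥ = 0)
    (hs : ∀ y : P, Nonempty ((Set.Icc (⊥ : P) y) ≃o Finset (Fin (ρ y))))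
    (S : Finset ℕ) (hS : S ⊆ Finset.Icc 1 n) :
    ∃ m M : ℕ, m ≤ n ∧
      (flags P ρ S).card = (Finset.univ.filter (fun y : P => ρ y = m)).card * M ∧
      ∀ k : Fin (n + 1), (Finset.univ.filter (fun w : Equiv.Perm (Fin (n + 1)) =>
        w 0 = k ∧ descSet w ⊆ S.image (fun a => n + 1 - a))).card =
        (n - k.1).choose (n - m) * M := by
  have hρ := rank_strictMono hs
  rcases S.eq_empty_or_nonempty with rfl | hne
  · refine ⟨0, 1, by omega, ?_, ?_⟩
    · have h1 : flags P ρ ∅ = {∅} := by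
        ext c
        rw [mem_flags, Finset.mem_singleton, Finset.image_eq_empty]
        constructor
        · exact fun h => h.2
        · rintro rfl; simp
      have h2 : Finset.univ.filter (fun y : P => ρ y = 0) = {⊥} := by
        ext y
        simp only [Finset.mem_filter, Finset.mem_univ, true_and, Finset.mem_singleton]
        constructor
        · intro h
          by_contra hy
          have := hρ (bot_lt_iff_ne_bot.2 hy)
          omega
        · rintro rfl; exact hbot
      rw [h1, h2]; simp
    · intro k
      rw [perm_count n ∅ hS k]
      have h1 : flags (Finset (Fin (n + 1))) Finset.card ∅ = {∅} := by
        ext c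
        rw [mem_flags, Finset.mem_singleton, Finset.image_eq_empty]
        constructor
        · exact fun h => h.2
        · rintro rfl; simp
      rw [h1, Finset.filter_singleton]
      by_cases hk : k = 0
      · subst hk; simp
      · have hk' : 0 < k := Fin.pos_iff_ne_zero.2 hk
        have hk'' : 0 < k.1 := hk'
        rw [if_neg, Nat.choose_eq_zero_of_lt (by omega)]
        · simp
        · rintro ⟨_, h⟩
          obtain ⟨B, hB, _⟩ := h 0 hk'
          simp at hB
  · set m := S.max' hne with hm
    have hmS : m ∈ S := S.max'_mem hne
    have hmn := Finset.mem_Icc.1 (hS hmS)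
    have hins : insert m (S.erase m) = S := Finset.insert_erase hmS
    have hlt : ∀ s ∈ S.erase m, s < m := fun s hs =>
      lt_of_le_of_ne (S.le_max' s (Finset.mem_of_mem_erase hs)) (Finset.ne_of_mem_erase hs)
    refine ⟨m, (flags (Finset (Fin m)) Finset.card (S.erase m)).card, hmn.2, ?_, ?_⟩
    · have := card_flags_insert hs (S.erase m) m hlt (fun _ => True)
      simpa [hins] using this
    · intro k
      have hkey : ((flags (Finset (Fin (n + 1))) Finset.card S).filter
          (fun c => ∀ B ∈ c, B.card = m → (k ∉ B ∧ ∀ a < k, a ∈ B))).card =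
          (Finset.univ.filter (fun B : Finset (Fin (n + 1)) =>
            B.card = m ∧ (k ∉ B ∧ ∀ a < k, a ∈ B))).card *
          (flags (Finset (Fin m)) Finset.card (S.erase m)).card := by
        have hkey' := card_flags_insert (fun B => finset_simp B) (S.erase m) m hlt
          (fun B : Finset (Fin (n + 1)) => k ∉ B ∧ ∀ a < k, a ∈ B)
        rw [hins] at hkey'
        convert hkey'
      have htops := count_tops n m hmn.2 k
      rw [perm_count n S hS k, ← htops]
      refine Eq.trans ?_ (hkey)
      congr 1
      ext c
      rw [Finset.mem_filter, Finset.mem_filter]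
      apply and_congr_right
      intro hc
      obtain ⟨h1, h2⟩ := mem_flags.1 hc
      obtain ⟨T, hT, hTm⟩ := Finset.mem_image.1 (h2 ▸ hmS : m ∈ c.image Finset.card)
      have hcard : StrictMono (Finset.card : Finset (Fin (n + 1)) → ℕ) := Finset.card_strictMono
      have htop : ∀ B ∈ c, B ≤ T := by
        intro B hB
        have hBS : B.card ∈ S := h2 ▸ Finset.mem_image_of_mem _ hB
        have hle := S.le_max' _ hBS
        rcases h1.total hB hT with h | h
        · exact h
        · exact (Finset.eq_of_subset_of_card_le h (by omega)).ge
      constructor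
      · rintro ⟨h3, h4⟩ B hB hBm
        refine ⟨h3 B hB, fun a ha => ?_⟩
        obtain ⟨A, hA, haA⟩ := h4 a ha
        have : B = T := chain_eq_of_rank hcard h1 hB hT (hBm.trans hTm.symm)
        rw [this]
        exact htop A hA haA
      · intro h
        obtain ⟨h3, h4⟩ := h T hT hTm
        exact ⟨fun B hB hk => h3 (htop B hB hk), fun a ha => ⟨T, hT, h4 a ha⟩⟩

lemma mobius_indicator (D S : Finset ℕ) (hDS : D ⊆ S) :
    ∑ R ∈ S.powerset, (-1 : ℤ) ^ (S.card - R.card) * (if D ⊆ R then 1 else 0) =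
      if D = S then 1 else 0 := by
  have h := Finset.prod_add (fun _ => (1 : ℤ)) (fun i => if i ∈ D then (0 : ℤ) else -1) S
  have h1 : ∀ R ∈ S.powerset, (-1 : ℤ) ^ (S.card - R.card) * (if D ⊆ R then 1 else 0) =
      (∏ i ∈ R, (1 : ℤ)) * ∏ i ∈ S \ R, (if i ∈ D then (0 : ℤ) else -1) := by
    intro R hR
    have hRS := Finset.mem_powerset.1 hR
    rw [Finset.prod_const_one, one_mul]
    by_cases hD : D ⊆ R
    · rw [if_pos hD, mul_one, ← Finset.card_sdiff_of_subset hRS, ← Finset.prod_const]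
      apply Finset.prod_congr rfl
      intro i hi
      rw [if_neg (fun h => (Finset.mem_sdiff.1 hi).2 (hD h))]
    · rw [if_neg hD, mul_zero]
      obtain ⟨i, hi, hiR⟩ := Finset.not_subset.1 hD
      symm
      exact Finset.prod_eq_zero (Finset.mem_sdiff.2 ⟨hDS hi, hiR⟩) (if_pos hi)
  rw [Finset.sum_congr rfl h1, ← h]
  by_cases hD : D = S
  · rw [if_pos hD]
    apply Finset.prod_eq_one
    intro i hi
    rw [if_pos (hD ▸ hi)]; norm_num
  · rw [if_neg hD]
    obtain ⟨i, hi, hiD⟩ := Finset.not_subset.1 (fun h => hD (Finset.Subset.antisymm hDS h))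
    exact Finset.prod_eq_zero hi (by rw [if_neg hiD]; norm_num)

lemma mobius_indicator' (D S : Finset ℕ) :
    ∑ R ∈ S.powerset, (-1 : ℤ) ^ (S.card - R.card) * (if D ⊆ R then 1 else 0) =
      if D = S then 1 else 0 := by
  by_cases h : D ⊆ S
  · exact mobius_indicator D S h
  · rw [if_neg (fun e => h e.le)]
    apply Finset.sum_eq_zero
    intro R hR
    rw [if_neg (fun e => h (e.trans (Finset.mem_powerset.1 hR))), mul_zero]

lemma image_rev_subset {n : ℕ} {D T : Finset ℕ} (hD : D ⊆ Finset.Icc 1 n)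
    (hT : T ⊆ Finset.Icc 1 n) :
    D ⊆ T.image (fun a => n + 1 - a) ↔ D.image (fun a => n + 1 - a) ⊆ T := by
  constructor
  · intro h x hx
    obtain ⟨d, hd, rfl⟩ := Finset.mem_image.1 hx
    obtain ⟨t, ht, rfl⟩ := Finset.mem_image.1 (h hd)
    have := Finset.mem_Icc.1 (hT ht)
    have e : n + 1 - (n + 1 - t) = t := by omega
    rw [e]; exact ht
  · intro h d hd
    have := Finset.mem_Icc.1 (hD hd)
    exact Finset.mem_image.2 ⟨n + 1 - d, h (Finset.mem_image_of_mem _ hd), by omega⟩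

lemma card_image_rev {n : ℕ} {D : Finset ℕ} (hD : D ⊆ Finset.Icc 1 n) :
    (D.image (fun a => n + 1 - a)).card = D.card := by
  apply Finset.card_image_of_injOn
  intro a ha b hb h
  have := Finset.mem_Icc.1 (hD ha)
  have := Finset.mem_Icc.1 (hD hb)
  simp only at h
  omega

/-- Let `P` be a graded simplicial poset of rank `n`.  Then for every
`T ⊆ [n]`,
`h(Δ(P̂_T), x) := Σ_{S ⊆ T} β_{P̂}(S) x^{|S|} = Σ_{k=0}^n h_k(P) · p^{(n+1)-T}_{n,k}(x)`,
where `(n+1) - T = {n+1-a : a ∈ T}`. -/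
theorem stmt12 (n : ℕ) (P : Type*) [Fintype P] [PartialOrder P] [OrderBot P]
    (ρ : P → ℕ) (hbot : ρ ⊥ = 0) (hcov : ∀ x y : P, x ⋖ y → ρ y = ρ x + 1)
    (hmax : ∀ x : P, IsMax x → ρ x = n)
    (hsimp : ∀ y : P, Nonempty ((Set.Icc (⊥ : P) y) ≃o Finset (Fin (ρ y))))
    (T : Finset ℕ) (hT : T ⊆ Finset.Icc 1 n) :
    (∑ S ∈ T.powerset, C ((betaP P ρ S : ℝ)) * X ^ S.card) =
      ∑ k ∈ Finset.range (n + 1),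
        C (((hpolyP P ρ n).coeff k : ℝ)) * ppoly n k (T.image (fun a => n + 1 - a)) := by
  have hρ := rank_strictMono hsimp
  have hr : ∀ w : Equiv.Perm (Fin (n + 1)), descSet w ⊆ Finset.Icc 1 n := descSet_subset
  set D : Equiv.Perm (Fin (n + 1)) → Finset ℕ :=
    fun w => (descSet w).image (fun a => n + 1 - a) with hD
  set h : ℕ → ℤ := fun k => (hpolyP P ρ n).coeff k with hh
  have halpha : ∀ S ⊆ Finset.Icc 1 n, (alphaP P ρ S : ℤ) =
      ∑ w : Equiv.Perm (Fin (n + 1)), h (w 0) * (if D w ⊆ S then 1 else 0) := by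
    intro S hS
    rw [alphaP_eq hρ hbot hcov hmax S hS]
    obtain ⟨m, M, hmn, h1, h2⟩ := count_formula (n := n) hbot hsimp S hS
    rw [h1]
    push_cast
    have hf := f_of_h n m hmn (fun i => ((Finset.univ.filter (fun y : P => ρ y = i)).card : ℤ))
    change ∑ k ∈ Finset.range (n + 1), (hpolyP P ρ n).coeff k *
      ((n - k).choose (n - m) : ℤ) = _ at hf
    rw [← hf, ← Finset.sum_fiberwise Finset.univ (fun w : Equiv.Perm (Fin (n + 1)) => w 0),
      Finset.sum_mul, ← Fin.sum_univ_eq_sum_range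
        (fun k => (hpolyP P ρ n).coeff k * ((n - k).choose (n - m) : ℤ) * (M : ℤ))]
    apply Finset.sum_congr rfl
    intro k _
    have h3 := h2 k
    have h4 : ∑ w ∈ Finset.univ.filter (fun w : Equiv.Perm (Fin (n + 1)) => w 0 = k),
        h (w 0) * (if D w ⊆ S then 1 else 0) =
        ∑ w ∈ Finset.univ.filter (fun w : Equiv.Perm (Fin (n + 1)) => w 0 = k),
        h k * (if D w ⊆ S then 1 else 0) := by
      apply Finset.sum_congr rfl
      intro w hw
      rw [(Finset.mem_filter.1 hw).2]
    rw [h4, ← Finset.mul_sum, mul_assoc]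
    congr 1
    rw [← Nat.cast_mul, ← h3, Finset.sum_boole, Finset.filter_filter]
    congr 2
    apply Finset.filter_congr
    intro w _
    rw [image_rev_subset (hr w) hS]
  have hbeta : ∀ S ⊆ Finset.Icc 1 n, betaP P ρ S =
      ∑ w : Equiv.Perm (Fin (n + 1)), h (w 0) * (if D w = S then 1 else 0) := by
    intro S hS
    unfold betaP
    have h1 : ∀ R ∈ S.powerset, (-1 : ℤ) ^ (S.card - R.card) * (alphaP P ρ R : ℤ) =
        ∑ w : Equiv.Perm (Fin (n + 1)), h (w 0) *
          ((-1 : ℤ) ^ (S.card - R.card) * (if D w ⊆ R then 1 else 0)) := by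
      intro R hR
      rw [halpha R ((Finset.mem_powerset.1 hR).trans hS), Finset.mul_sum]
      apply Finset.sum_congr rfl
      intro w _
      ring
    rw [Finset.sum_congr rfl h1, Finset.sum_comm]
    apply Finset.sum_congr rfl
    intro w _
    rw [← Finset.mul_sum, mobius_indicator']
  have hL : ∀ S ∈ T.powerset, C ((betaP P ρ S : ℝ)) * X ^ S.card =
      ∑ w : Equiv.Perm (Fin (n + 1)), (if D w = S then
        C ((h (w 0) : ℝ)) * X ^ (descSet w).card else 0 : Polynomial ℝ) := by
    intro S hS
    rw [hbeta S ((Finset.mem_powerset.1 hS).trans hT)]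
    push_cast
    rw [map_sum, Finset.sum_mul]
    apply Finset.sum_congr rfl
    intro w _
    by_cases hw : D w = S
    · rw [if_pos hw, if_pos hw, ← hw, hD]
      simp only
      rw [card_image_rev (hr w)]
      simp
    · rw [if_neg hw, if_neg hw]; simp
  rw [Finset.sum_congr rfl hL, Finset.sum_comm,
    ← Finset.sum_fiberwise Finset.univ (fun w : Equiv.Perm (Fin (n + 1)) => w 0),
    ← Fin.sum_univ_eq_sum_range (fun k => C (((hpolyP P ρ n).coeff k : ℝ)) *
      ppoly n k (T.image (fun a => n + 1 - a)))]
  apply Finset.sum_congr rfl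
  intro k _
  unfold ppoly
  rw [Finset.mul_sum]
  have hset : Finset.univ.filter (fun w : Equiv.Perm (Fin (n + 1)) =>
      (w 0 : ℕ) = (k : ℕ) ∧ descSet w ⊆ T.image (fun a => n + 1 - a)) =
      (Finset.univ.filter (fun w : Equiv.Perm (Fin (n + 1)) => w 0 = k)).filter
        (fun w => D w ⊆ T) := by
    rw [Finset.filter_filter]
    apply Finset.filter_congr
    intro w _
    rw [image_rev_subset (hr w) hT, Fin.ext_iff]
  rw [hset, Finset.sum_filter (p := fun w => D w ⊆ T)]
  apply Finset.sum_congr rfl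
  intro w hw
  rw [Finset.sum_ite_eq]
  simp only [Finset.mem_powerset]
  rw [(Finset.mem_filter.1 hw).2]
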